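/- Let α ∈ ℝ and α̃ = max{1−α, 0}, and let 𝒬 = diag(𝒬₁,…,𝒬_N), 𝒮 = diag(𝒮₁,…,𝒮_N), ℛ = diag(ℛ₁,…,ℛ_N) be block-diagonal with blocks in ℝ^{m×m}, each 𝒬_i and ℛ_i symmetric. If for every i = 1,…,N: 𝒮_i = (α/2)I, −(1/(2d_i))I ≺ 𝒬_i ≺ 0, and ℛ_i ≻ 2d_i α̃ I, then the dual global LMI under Laplacian coupling H = −L holds: L𝒬L + L𝒮 + 𝒮ᵀL + ℛ ≻ 0. -/

import Mathlib

open Matrix Kronecker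

/-- Block-diagonal matrix built from `N` blocks of size `a × b`. -/
def blkDiag {N a b : ℕ} (M : Fin N → Matrix (Fin a) (Fin b) ℝ) :
    Matrix (Fin N × Fin a) (Fin N × Fin b) ℝ :=
  Matrix.of fun x y => if x.1 = y.1 then M x.1 x.2 y.2 else 0

/-- The quadratic form of a weighted Laplacian is half the weighted sum of squared differences. -/
lemma sum_mul_laplacian_eq {ι : Type*} [Fintype ι] {A : ι → ι → ℝ} {d : ι → ℝ}
    (hA : ∀ i j, A i j = A j i) (hd : ∀ i, d i = ∑ j, A i j) (u : ι → ℝ) :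
    ∑ i, u i * (d i * u i - ∑ j, A i j * u j) =
      (∑ i, ∑ j, A i j * (u i - u j) ^ 2) / 2 := by
  have h1 : ∑ i, ∑ j, A i j * u j ^ 2 = ∑ i, ∑ j, A i j * u i ^ 2 := by
    rw [Finset.sum_comm]
    simp_rw [fun i j => hA j i]
  have h2 : ∑ i, ∑ j, A i j * (u i - u j) ^ 2 =
      ∑ i, ∑ j, A i j * u i ^ 2 + ∑ i, ∑ j, A i j * u j ^ 2 -
        2 * ∑ i, ∑ j, A i j * (u i * u j) := by
    simp_rw [Finset.mul_sum, ← Finset.sum_add_distrib, ← Finset.sum_sub_distrib]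
    exact Finset.sum_congr rfl fun i _ => Finset.sum_congr rfl fun j _ => by ring
  have h3 : ∑ i, u i * (d i * u i - ∑ j, A i j * u j) =
      ∑ i, ∑ j, A i j * u i ^ 2 - ∑ i, ∑ j, A i j * (u i * u j) := by
    simp_rw [hd, Finset.sum_mul, ← Finset.sum_sub_distrib, Finset.mul_sum]
    exact Finset.sum_congr rfl fun i _ => Finset.sum_congr rfl fun j _ => by ring
  rw [h3, h2, h1]
  ring

/-- A weighted Laplacian satisfies `ℒ ≤ 2𝒟` as a quadratic form. -/
lemma sum_mul_laplacian_le {ι : Type*} [Fintype ι] {A : ι → ι → ℝ} {d : ι → ℝ}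
    (hA : ∀ i j, A i j = A j i) (hA0 : ∀ i j, 0 ≤ A i j) (hd : ∀ i, d i = ∑ j, A i j)
    (u : ι → ℝ) :
    ∑ i, u i * (d i * u i - ∑ j, A i j * u j) ≤ ∑ i, 2 * d i * u i ^ 2 := by
  have h1 : ∑ i, ∑ j, A i j * u j ^ 2 = ∑ i, ∑ j, A i j * u i ^ 2 := by
    rw [Finset.sum_comm]
    simp_rw [fun i j => hA j i]
  have h2 : ∑ i, ∑ j, A i j * (u i - u j) ^ 2 ≤
      2 * (∑ i, ∑ j, A i j * u i ^ 2) + 2 * ∑ i, ∑ j, A i j * u j ^ 2 := by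
    simp_rw [Finset.mul_sum, ← Finset.sum_add_distrib]
    refine Finset.sum_le_sum fun i _ => Finset.sum_le_sum fun j _ => ?_
    nlinarith [mul_nonneg (hA0 i j) (sq_nonneg (u i + u j))]
  have h3 : ∑ i, 2 * d i * u i ^ 2 = 2 * ∑ i, ∑ j, A i j * u i ^ 2 := by
    simp_rw [hd, mul_assoc, Finset.sum_mul, Finset.mul_sum]
  rw [sum_mul_laplacian_eq hA hd, h3]
  linarith

/-- A weighted Laplacian satisfies `ℒ (2𝒟)⁻¹ ℒ ≤ ℒ` as a quadratic form. -/
lemma sum_laplacian_sq_div_le {ι : Type*} [Fintype ι] {A : ι → ι → ℝ} {d : ι → ℝ}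
    (hA : ∀ i j, A i j = A j i) (hA0 : ∀ i j, 0 ≤ A i j) (hd : ∀ i, d i = ∑ j, A i j)
    (hd0 : ∀ i, 0 < d i) (u : ι → ℝ) :
    ∑ i, 1 / (2 * d i) * (d i * u i - ∑ j, A i j * u j) ^ 2 ≤
      ∑ i, u i * (d i * u i - ∑ j, A i j * u j) := by
  rw [sum_mul_laplacian_eq hA hd, Finset.sum_div]
  refine Finset.sum_le_sum fun i _ => ?_
  have h1 : d i * u i - ∑ j, A i j * u j = ∑ j, A i j * (u i - u j) := by
    simp_rw [mul_sub, Finset.sum_sub_distrib, ← Finset.sum_mul, ← hd]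
  have h2 : (∑ j, A i j * (u i - u j)) ^ 2 ≤ d i * ∑ j, A i j * (u i - u j) ^ 2 := by
    rw [hd i]
    refine Finset.sum_sq_le_sum_mul_sum_of_sq_le_mul _ (fun j _ => hA0 i j)
      (fun j _ => mul_nonneg (hA0 i j) (sq_nonneg _)) fun j _ => le_of_eq (by ring)
  have := hd0 i
  rw [h1, one_div_mul_eq_div, div_le_div_iff₀ (by positivity) two_pos]
  linarith

lemma blkDiag_mulVec {N a b : ℕ} (M : Fin N → Matrix (Fin a) (Fin b) ℝ)
    (x : Fin N × Fin b → ℝ) (p : Fin N × Fin a) :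
    (blkDiag M *ᵥ x) p = (M p.1 *ᵥ fun k => x (p.1, k)) p.2 := by
  simp [blkDiag, mulVec, dotProduct, Fintype.sum_prod_type, ite_mul, Finset.sum_ite_irrel]

lemma dotProduct_blkDiag_mulVec {N a : ℕ} (M : Fin N → Matrix (Fin a) (Fin a) ℝ)
    (x : Fin N × Fin a → ℝ) :
    x ⬝ᵥ blkDiag M *ᵥ x = ∑ i, (fun k => x (i, k)) ⬝ᵥ M i *ᵥ fun k => x (i, k) := by
  simp only [dotProduct, Fintype.sum_prod_type, blkDiag_mulVec]

lemma blkDiag_isSymm {N a : ℕ} {M : Fin N → Matrix (Fin a) (Fin a) ℝ}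
    (hM : ∀ i, (M i).IsSymm) : (blkDiag M).IsSymm := by
  ext ⟨i, k⟩ ⟨j, l⟩
  by_cases h : i = j
  · subst h
    simp [blkDiag, (hM i).apply k l]
  · simp [blkDiag, h, Ne.symm h]

lemma blkDiag_smul_one {N a : ℕ} (c : ℝ) :
    (blkDiag fun _ : Fin N => c • (1 : Matrix (Fin a) (Fin a) ℝ)) = c • 1 := by
  ext ⟨i, k⟩ ⟨j, l⟩
  by_cases h : i = j <;> simp [blkDiag, Matrix.one_apply, h]

lemma kronecker_one_mulVec {N m : ℕ} (B : Matrix (Fin N) (Fin N) ℝ)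
    (x : Fin N × Fin m → ℝ) (i : Fin N) (k : Fin m) :
    ((B ⊗ₖ (1 : Matrix (Fin m) (Fin m) ℝ)) *ᵥ x) (i, k) = ∑ j, B i j * x (j, k) := by
  simp [mulVec, dotProduct, Fintype.sum_prod_type, Matrix.one_apply]

/-- The quadratic form of a multiple of the identity. -/
lemma dotProduct_mulVec_smul_one {m : ℕ} (c : ℝ) (v : Fin m → ℝ) :
    v ⬝ᵥ (c • (1 : Matrix (Fin m) (Fin m) ℝ)) *ᵥ v = ∑ k, c * v k ^ 2 := by
  rw [smul_mulVec, one_mulVec, dotProduct]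
  exact Finset.sum_congr rfl fun k _ => by simp only [Pi.smul_apply, smul_eq_mul]; ring

/-- Decentralized dual condition: if `𝒮_i = (α/2)I`, `−(1/(2d_i))I ≺ 𝒬_i ≺ 0` and
`ℛ_i ≻ 2d_iα̃I` with `α̃ = max{1−α, 0}`, then the dual global LMI under Laplacian coupling
`H = −L` holds: `L𝒬L + L𝒮 + 𝒮ᵀL + ℛ ≻ 0`. -/
theorem decentralized_dual_LMI_alpha {N m : ℕ}
    (𝒜 : Matrix (Fin N) (Fin N) ℝ)
    (h𝒜symm : 𝒜.IsSymm) (h𝒜nonneg : ∀ i j, 0 ≤ 𝒜 i j) (h𝒜diag : ∀ i, 𝒜 i i = 0)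
    (d : Fin N → ℝ) (hd : ∀ i, d i = ∑ j, 𝒜 i j) (hdpos : ∀ i, 0 < d i)
    (ℒ : Matrix (Fin N) (Fin N) ℝ) (hℒ : ℒ = Matrix.diagonal d - 𝒜)
    (hconn : ∀ v : Fin N → ℝ, ℒ *ᵥ v = 0 → ∃ c : ℝ, v = fun _ => c)
    (L : Matrix (Fin N × Fin m) (Fin N × Fin m) ℝ)
    (hL : L = ℒ ⊗ₖ (1 : Matrix (Fin m) (Fin m) ℝ))
    (sQ sS sR : Fin N → Matrix (Fin m) (Fin m) ℝ)
    (hsQsymm : ∀ i, (sQ i).IsSymm) (hsRsymm : ∀ i, (sR i).IsSymm)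
    (α αt : ℝ) (hαt : αt = max (1 - α) 0)
    (hsS : ∀ i, sS i = (α / 2) • (1 : Matrix (Fin m) (Fin m) ℝ))
    (hsQlb : ∀ i, (sQ i + (1 / (2 * d i)) • (1 : Matrix (Fin m) (Fin m) ℝ)).PosDef)
    (hsQneg : ∀ i, (-(sQ i)).PosDef)
    (hsRlb : ∀ i, (sR i - (2 * d i * αt) • (1 : Matrix (Fin m) (Fin m) ℝ)).PosDef) :
    (L * blkDiag sQ * L + L * blkDiag sS + (blkDiag sS)ᵀ * L + blkDiag sR).PosDef := by
  have hA : ∀ i j, 𝒜 i j = 𝒜 j i := fun i j => h𝒜symm.apply j i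
  have hℒsymm : ℒᵀ = ℒ := by
    rw [hℒ, transpose_sub, diagonal_transpose, h𝒜symm.eq]
  have hLsymm : Lᵀ = L := by
    rw [hL, ← kroneckerMap_transpose, hℒsymm, transpose_one]
  have hS : blkDiag sS = (α / 2) • (1 : Matrix (Fin N × Fin m) (Fin N × Fin m) ℝ) := by
    rw [funext hsS, blkDiag_smul_one]
  have hM : L * blkDiag sQ * L + L * blkDiag sS + (blkDiag sS)ᵀ * L + blkDiag sR =
      L * blkDiag sQ * L + α • L + blkDiag sR := by
    rw [hS, transpose_smul, transpose_one, Matrix.mul_smul, Matrix.smul_mul, Matrix.mul_one, Matrix.one_mul,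
      add_assoc (L * blkDiag sQ * L), ← add_smul, add_halves]
  rw [hM]
  refine PosDef.of_dotProduct_mulVec_pos ?_ fun x hx => ?_
  · rw [IsHermitian, conjTranspose_eq_transpose_of_trivial, transpose_add, transpose_add,
      transpose_mul, transpose_mul, transpose_smul, hLsymm, (blkDiag_isSymm hsQsymm).eq,
      (blkDiag_isSymm hsRsymm).eq, Matrix.mul_assoc]
  set y := L *ᵥ x with hy
  have hy_apply : ∀ i k, y (i, k) = d i * x (i, k) - ∑ j, 𝒜 i j * x (j, k) := by
    intro i k
    rw [hy, hL, kronecker_one_mulVec, hℒ]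
    simp [sub_mul, Finset.sum_sub_distrib, diagonal_apply]
  have hform : star x ⬝ᵥ (L * blkDiag sQ * L + α • L + blkDiag sR) *ᵥ x =
      y ⬝ᵥ blkDiag sQ *ᵥ y + α * (x ⬝ᵥ y) + x ⬝ᵥ blkDiag sR *ᵥ x := by
    have hxL : x ᵥ* L = y := by rw [← mulVec_transpose, hLsymm]
    rw [star_trivial, add_mulVec, add_mulVec, dotProduct_add, dotProduct_add, smul_mulVec,
      dotProduct_smul, smul_eq_mul, ← mulVec_mulVec, ← mulVec_mulVec, dotProduct_mulVec x L,
      hxL]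
  have hQ : -(∑ i, ∑ k, 1 / (2 * d i) * y (i, k) ^ 2) ≤ y ⬝ᵥ blkDiag sQ *ᵥ y := by
    rw [dotProduct_blkDiag_mulVec, ← Finset.sum_neg_distrib]
    refine Finset.sum_le_sum fun i _ => ?_
    have h := (hsQlb i).posSemidef.dotProduct_mulVec_nonneg fun k => y (i, k)
    rw [star_trivial, add_mulVec, dotProduct_add, dotProduct_mulVec_smul_one] at h
    linarith
  have hR : ∑ i, ∑ k, 2 * d i * αt * x (i, k) ^ 2 < x ⬝ᵥ blkDiag sR *ᵥ x := by
    rw [dotProduct_blkDiag_mulVec]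
    have key : ∀ i v, star v ⬝ᵥ (sR i - (2 * d i * αt) • (1 : Matrix (Fin m) (Fin m) ℝ)) *ᵥ v =
        v ⬝ᵥ sR i *ᵥ v - ∑ k, 2 * d i * αt * v k ^ 2 := fun i v => by
      rw [star_trivial, sub_mulVec, dotProduct_sub, dotProduct_mulVec_smul_one]
    obtain ⟨⟨i, k⟩, hik⟩ := Function.ne_iff.mp hx
    refine Finset.sum_lt_sum (fun j _ => ?_) ⟨i, Finset.mem_univ i, ?_⟩
    · have h := (hsRlb j).posSemidef.dotProduct_mulVec_nonneg fun k => x (j, k)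
      rw [key] at h
      linarith
    · have h := (hsRlb i).dotProduct_mulVec_pos (x := fun k => x (i, k))
        fun h => hik (congrFun h k)
      rw [key] at h
      linarith
  have hxy : x ⬝ᵥ y = ∑ k, ∑ i, x (i, k) * (d i * x (i, k) - ∑ j, 𝒜 i j * x (j, k)) := by
    rw [dotProduct, Fintype.sum_prod_type, Finset.sum_comm]
    simp_rw [hy_apply]
  have hlow : ∑ i, ∑ k, 1 / (2 * d i) * y (i, k) ^ 2 ≤ x ⬝ᵥ y := by
    rw [hxy, Finset.sum_comm]
    simp_rw [hy_apply]
    exact Finset.sum_le_sum fun k _ =>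
      sum_laplacian_sq_div_le hA h𝒜nonneg hd hdpos fun i => x (i, k)
  have hup : αt * (x ⬝ᵥ y) ≤ ∑ i, ∑ k, 2 * d i * αt * x (i, k) ^ 2 := by
    have h : x ⬝ᵥ y ≤ ∑ k, ∑ i, 2 * d i * x (i, k) ^ 2 := by
      rw [hxy]
      exact Finset.sum_le_sum fun k _ => sum_mul_laplacian_le hA h𝒜nonneg hd fun i => x (i, k)
    refine (mul_le_mul_of_nonneg_left h (hαt ▸ le_max_right _ _)).trans_eq ?_
    rw [Finset.sum_comm]
    simp_rw [Finset.mul_sum]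
    exact Finset.sum_congr rfl fun i _ => Finset.sum_congr rfl fun k _ => by ring
  have hxy0 : 0 ≤ x ⬝ᵥ y := le_trans
    (Finset.sum_nonneg fun i _ => Finset.sum_nonneg fun k _ =>
      mul_nonneg (one_div_nonneg.mpr (mul_pos two_pos (hdpos i)).le) (sq_nonneg _)) hlow
  have hα : (1 - α) * (x ⬝ᵥ y) ≤ αt * (x ⬝ᵥ y) :=
    mul_le_mul_of_nonneg_right (hαt ▸ le_max_left _ _) hxy0
  rw [hform]
  linarith
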